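/- There is no function Ψ : (ℕ → ℕ → Bool) → (ℕ → Bool) such that (i) for every relation code P for which ≤_P is reflexive, transitive and antisymmetric (i.e. P codes a partial order on ℕ), the set S = {n | Ψ P n = true} is infinite and is either a chain for P (any two elements of S are ≤_P-comparable) or an antichain for P (no two distinct elements of S are ≤_P-comparable), and (ii) Ψ is continuous at the code of the usual order on ℕ. (This is the set-theoretic content of the paper's Corollary that the uniform chain-antichain principle UCAC is equivalent to arithmetical comprehension.) -/

import Mathlib

/-- `P` codes a partial order on `ℕ`. -/
def PartialOrderCode (P : ℕ → ℕ → Bool) : Prop :=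
  (∀ x, P x x = true) ∧
  (∀ x y z, P x y = true → P y z = true → P x z = true) ∧
  (∀ x y, P x y = true → P y x = true → x = y)

/-- The relation that agrees with the usual order below `K` and makes every `n ≥ K` comparable
only to itself. -/
def truncatedOrder (K a b : ℕ) : Bool :=
  decide (a = b ∨ (a ≤ b ∧ b < K))

theorem partialOrderCode_le : PartialOrderCode (fun a b => decide (a ≤ b)) := by
  refine ⟨?_, ?_, ?_⟩ <;> simp only [decide_eq_true_eq] <;> omega

theorem partialOrderCode_truncatedOrder (K : ℕ) : PartialOrderCode (truncatedOrder K) := by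
  refine ⟨?_, ?_, ?_⟩ <;> simp only [truncatedOrder, decide_eq_true_eq, true_or, implies_true] <;> omega

theorem tendsto_truncatedOrder :
    Filter.Tendsto truncatedOrder Filter.atTop (nhds fun a b => decide (a ≤ b)) := by
  refine tendsto_pi_nhds.2 fun a => tendsto_pi_nhds.2 fun b => ?_
  refine tendsto_const_nhds.congr' ?_
  filter_upwards [Filter.eventually_gt_atTop b] with K hK
  simp only [truncatedOrder, decide_eq_decide]
  omega

/-- There is no uniform CAC-functional that is continuous at the usual order on `ℕ`. -/
theorem no_continuous_uniform_CAC :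
    ¬ ∃ Ψ : (ℕ → ℕ → Bool) → (ℕ → Bool),
      (∀ P : ℕ → ℕ → Bool, PartialOrderCode P →
        {n | Ψ P n = true}.Infinite ∧
        ((∀ a b, Ψ P a = true → Ψ P b = true → P a b = true ∨ P b a = true) ∨
         (∀ a b, Ψ P a = true → Ψ P b = true → a ≠ b →
           ¬ P a b = true ∧ ¬ P b a = true))) ∧
      ContinuousAt Ψ (fun a b => decide (a ≤ b)) := by
  rintro ⟨Ψ, hΨ, hcont⟩
  have hlim := hcont.tendsto.comp tendsto_truncatedOrder
  have eventually_mem : ∀ n, Ψ (fun a b => decide (a ≤ b)) n = true →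
      ∀ᶠ K in Filter.atTop, Ψ (truncatedOrder K) n = true := by
    intro n hn
    have h := tendsto_pi_nhds.1 hlim n
    rw [hn, nhds_discrete, Filter.tendsto_pure] at h
    exact h
  have hinf := (hΨ _ partialOrderCode_le).1
  obtain ⟨m, hm⟩ := hinf.nonempty
  obtain ⟨n, hn, hmn⟩ := hinf.exists_gt m
  obtain ⟨K, hmK, hnK, hK⟩ := ((eventually_mem m hm).and
    ((eventually_mem n hn).and (Filter.eventually_gt_atTop n))).exists
  obtain ⟨hKinf, hchain | hanti⟩ := hΨ _ (partialOrderCode_truncatedOrder K)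
  · obtain ⟨j, hj, hKj⟩ := hKinf.exists_gt K
    have h := hchain m j hmK hj
    simp only [truncatedOrder, decide_eq_true_eq] at h
    omega
  · have h := (hanti m n hmK hnK hmn.ne).1
    simp only [truncatedOrder, decide_eq_true_eq] at h
    omega
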